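/- Let X be a geodesic δ-hyperbolic metric space, let G be a group that is not virtually cyclic acting on X by isometries with a unital axial WPD loxodromic element f ∈ G, let x₀ ∈ Ax(f), and let S be a finite generating set of G. Then there exists D₀ > 0 such that for every D ≥ D₀ and every E > 0 there exists E' > 0 with the following property: if g ∈ G satisfies (1) there is no h ∈ G with ‖h‖_S ≤ E' and d_{h·Ax(f)}(x₀, gx₀) ≥ 250D, and (2) ‖g‖_S ≥ E, then every d_S-path (id = g₀, g₁, …, g_N = g) from id to g contains some g_t with g_t ∈ 𝒩𝓕_{300D} and ‖g_t‖_S ≥ E. -/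

import Mathlib

noncomputable section

open Set Metric Pointwise

/-- The Gromov product `(y|z)_x`. -/
def gromovProd {X : Type*} [MetricSpace X] (x y z : X) : ℝ :=
  (dist x y + dist x z - dist y z) / 2

/-- `γ` restricted to `[a, b]` is a unit-speed geodesic. -/
def IsGeodesicParam {X : Type*} [MetricSpace X] (γ : ℝ → X) (a b : ℝ) : Prop :=
  ∀ s ∈ Set.Icc a b, ∀ t ∈ Set.Icc a b, dist (γ s) (γ t) = |s - t|

/-- `γ` is a geodesic from `x` to `y`, parametrized by arclength on `[0, dist x y]`. -/
def IsGeodesicBetween {X : Type*} [MetricSpace X] (γ : ℝ → X) (x y : X) : Prop :=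
  γ 0 = x ∧ γ (dist x y) = y ∧ IsGeodesicParam γ 0 (dist x y)

/-- A geodesic metric space: any two points are joined by a geodesic. -/
def GeodesicSpace (X : Type*) [MetricSpace X] : Prop :=
  ∀ x y : X, ∃ γ : ℝ → X, IsGeodesicBetween γ x y

/-- A geodesic space in which every geodesic triangle is `δ`-thin. -/
def GromovHyperbolic (X : Type*) [MetricSpace X] (δ : ℝ) : Prop :=
  GeodesicSpace X ∧
    ∀ (x y z : X) (γ₁ γ₂ γ₃ : ℝ → X),
      IsGeodesicBetween γ₁ x z → IsGeodesicBetween γ₂ x y → IsGeodesicBetween γ₃ y z →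
        ∀ t ∈ Set.Icc (0 : ℝ) (dist x z),
          ∃ u ∈ γ₂ '' Set.Icc (0 : ℝ) (dist x y) ∪ γ₃ '' Set.Icc (0 : ℝ) (dist y z),
            dist (γ₁ t) u ≤ δ

/-- A subset of `X` which is the image of a geodesic segment. -/
def IsGeodesicSegSet {X : Type*} [MetricSpace X] (A : Set X) : Prop :=
  ∃ (γ : ℝ → X) (a b : ℝ), a ≤ b ∧ IsGeodesicParam γ a b ∧ A = γ '' Set.Icc a b

/-- The set of nearest-point projections of `x` to `A`. -/
def nearestPts {X : Type*} [MetricSpace X] (A : Set X) (x : X) : Set X :=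
  {a ∈ A | dist x a = Metric.infDist x A}

/-- The nearest-point projection of the set `B` to `A`. -/
def projSet {X : Type*} [MetricSpace X] (A B : Set X) : Set X := ⋃ x ∈ B, nearestPts A x

/-- `diam_A(B)`, the diameter of the projection of `B` to `A`. -/
def projDiam {X : Type*} [MetricSpace X] (A B : Set X) : ℝ := Metric.diam (projSet A B)

/-- `d_A(B, C) = diam (π_A (B ∪ C))`. -/
def projDist {X : Type*} [MetricSpace X] (A B C : Set X) : ℝ := Metric.diam (projSet A (B ∪ C))

/-- The halfspace `H_half(x, y)` of points at least as close to `x` as to `y`. -/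
def halfspace {X : Type*} [MetricSpace X] (x y : X) : Set X := {z | dist z x ≤ dist z y}

/-- A group is virtually cyclic if it has a cyclic subgroup of finite index. -/
def VirtuallyCyclic (G : Type*) [Group G] : Prop :=
  ∃ H : Subgroup G, H.FiniteIndex ∧ IsCyclic H

/-- The WPD property for `f` relative to the basepoint `x₀`. -/
def WPD {G : Type*} [Group G] {X : Type*} [MetricSpace X] [MulAction G X]
    (f : G) (x₀ : X) : Prop :=
  ∀ R : ℝ, 0 < R → ∃ L : ℕ, 0 < L ∧
    {g : G | dist x₀ (g • x₀) < R ∧ dist ((f ^ L) • x₀) ((g * f ^ L) • x₀) < R}.Finite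

/-- The word norm with respect to the generating set `S`. -/
def wordNorm {G : Type*} [Group G] (S : Finset G) (g : G) : ℕ :=
  sInf {n : ℕ | ∃ l : List G, l.length = n ∧ (∀ x ∈ l, x ∈ S ∨ x⁻¹ ∈ S) ∧ l.prod = g}

/-- The word metric with respect to the generating set `S`. -/
def wordDist {G : Type*} [Group G] (S : Finset G) (g h : G) : ℕ := wordNorm S (g⁻¹ * h)

/-- `B` is an `r`-roughly branching subset of `G`. -/
def RoughlyBranching {G : Type*} [Group G] (S : Finset G) (r : ℝ) (B : Set G) : Prop :=
  ∃ B' : Set G,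
    (∀ b ∈ B, ∃ b' ∈ B', (wordDist S b b' : ℝ) ≤ r) ∧
    ∀ k : ℕ, 1 ≤ k → ∀ g h : Fin k → G, (∀ i, g i ∈ B') → (∀ i, h i ∈ B') →
      (List.ofFn g).prod = (List.ofFn h).prod → g = h

/-- The four-point form of Gromov hyperbolicity. -/
def FourPoint (X : Type*) [MetricSpace X] (K : ℝ) : Prop :=
  ∀ x y z w : X, dist x z + dist y w ≤ dist x y + dist z w + K ∨
    dist x z + dist y w ≤ dist x w + dist y z + K

theorem IsGeodesicBetween.dist_add {X : Type*} [MetricSpace X] {γ : ℝ → X} {x y : X}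
    (h : IsGeodesicBetween γ x y) {t : ℝ} (ht : t ∈ Icc (0 : ℝ) (dist x y)) :
    dist x (γ t) + dist (γ t) y = dist x y := by
  obtain ⟨h0, h1, h⟩ := h
  have e1 := h 0 ⟨le_rfl, dist_nonneg⟩ t ht
  have e2 := h t ht _ ⟨dist_nonneg, le_rfl⟩
  rw [h0, zero_sub, abs_neg, abs_of_nonneg ht.1] at e1
  rw [h1, abs_sub_comm, abs_of_nonneg (sub_nonneg.2 ht.2)] at e2
  linarith

/-- Some point of a geodesic `[x, z]` is at distance about `(x|z)_w` from `w`. -/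
theorem GromovHyperbolic.exists_dist_le_gromovProd {X : Type*} [MetricSpace X] {δ : ℝ}
    (hX : GromovHyperbolic X δ) (hδ : 0 ≤ δ) (w x z : X) {γ : ℝ → X}
    (hγ : IsGeodesicBetween γ x z) :
    ∃ t ∈ Icc (0 : ℝ) (dist x z), dist w (γ t) ≤ gromovProd w x z + 2 * (δ + 1) := by
  obtain ⟨α, hα⟩ := hX.1 x w
  obtain ⟨β, hβ⟩ := hX.1 w z
  set A : Set ℝ := {t | t ∈ Icc (0 : ℝ) (dist x z) ∧
    ∃ s ∈ Icc (0 : ℝ) (dist x w), dist (γ t) (α s) ≤ δ}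
  have hthin := hX.2 x w z γ α β hγ hα hβ
  have h0 : (0 : ℝ) ∈ A := by
    refine ⟨⟨le_rfl, dist_nonneg⟩, 0, ⟨le_rfl, dist_nonneg⟩, ?_⟩
    rw [hγ.1, hα.1, dist_self]
    exact hδ
  have hbdd : BddAbove A := ⟨dist x z, fun t ht => ht.1.2⟩
  obtain ⟨t, ht, hlt⟩ := exists_lt_of_lt_csSup ⟨0, h0⟩ (sub_one_lt (sSup A))
  obtain ⟨htI, s, hs, hts⟩ := ht
  have hB : ∃ t' ∈ Icc (0 : ℝ) (dist x z), |t - t'| ≤ 1 ∧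
      ∃ s' ∈ Icc (0 : ℝ) (dist w z), dist (γ t') (β s') ≤ δ := by
    by_cases h : t + 1 ≤ dist x z
    · have hI : t + 1 ∈ Icc (0 : ℝ) (dist x z) := ⟨by linarith [htI.1], h⟩
      refine ⟨t + 1, hI, by simp, ?_⟩
      obtain ⟨u, hu | hu, hd⟩ := hthin _ hI
      · obtain ⟨s', hs', rfl⟩ := hu
        have : t + 1 ≤ sSup A := le_csSup hbdd ⟨hI, s', hs', hd⟩
        linarith
      · obtain ⟨s', hs', rfl⟩ := hu
        exact ⟨s', hs', hd⟩
    · refine ⟨dist x z, ⟨dist_nonneg, le_rfl⟩, ?_, dist w z, ⟨dist_nonneg, le_rfl⟩, ?_⟩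
      · rw [abs_le]
        constructor <;> linarith [htI.2]
      · rw [hγ.2.1, hβ.2.1, dist_self]
        exact hδ
  obtain ⟨t', ht', htt', s', hs', hts'⟩ := hB
  refine ⟨t, htI, ?_⟩
  have e1 := hα.dist_add hs
  have e2 := hβ.dist_add hs'
  have e3 := hγ.dist_add htI
  have e4 : dist (γ t) (γ t') ≤ 1 := by rw [hγ.2.2 t htI t' ht']; exact htt'
  have e5 : dist (γ t) (β s') ≤ δ + 1 := (dist_triangle _ (γ t') _).trans (by linarith)
  have t1 := dist_triangle x (α s) (γ t)
  have t2 := dist_triangle w (α s) (γ t)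
  have t3 := dist_triangle w (β s') (γ t)
  have t4 := dist_triangle (γ t) (β s') z
  rw [dist_comm (α s) (γ t)] at t1 t2
  rw [dist_comm (β s') (γ t)] at t3
  rw [dist_comm (α s) w] at e1
  unfold gromovProd
  rw [dist_comm w x]
  linarith

theorem GromovHyperbolic.fourPoint {X : Type*} [MetricSpace X] {δ : ℝ}
    (hX : GromovHyperbolic X δ) (hδ : 0 ≤ δ) : FourPoint X (6 * δ + 4) := by
  intro x y z w
  obtain ⟨γ, hγ⟩ := hX.1 x z
  obtain ⟨α, hα⟩ := hX.1 x y
  obtain ⟨β, hβ⟩ := hX.1 y z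
  obtain ⟨t, ht, hd⟩ := hX.exists_dist_le_gromovProd hδ w x z hγ
  obtain ⟨u, hu, hdu⟩ := hX.2 x y z γ α β hγ hα hβ t ht
  have t0 := dist_triangle w (γ t) u
  unfold gromovProd at hd
  have c1 := dist_comm w x
  have c2 := dist_comm w z
  have c3 := dist_comm w y
  rcases hu with ⟨s, hs, rfl⟩ | ⟨s, hs, rfl⟩
  · left
    have e := hα.dist_add hs
    have t1 := dist_triangle w (α s) x
    have t2 := dist_triangle w (α s) y
    have c4 := dist_comm (α s) x
    linarith
  · right
    have e := hβ.dist_add hs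
    have t1 := dist_triangle w (β s) z
    have t2 := dist_triangle w (β s) y
    have c4 := dist_comm (β s) y
    linarith

/-- `γ` is an isometrically embedded line. -/
def IsGeodesicLine {X : Type*} [MetricSpace X] (γ : ℝ → X) : Prop :=
  ∀ s t : ℝ, dist (γ s) (γ t) = |s - t|

/-- `γ p` is a nearest point of `γ` to `x`. -/
def IsNearestParam {X : Type*} [MetricSpace X] (γ : ℝ → X) (x : X) (p : ℝ) : Prop :=
  ∀ s : ℝ, dist x (γ p) ≤ dist x (γ s)

theorem IsGeodesicLine.exists_isNearestParam {X : Type*} [MetricSpace X] {γ : ℝ → X}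
    (hγ : IsGeodesicLine γ) (x : X) : ∃ p, IsNearestParam γ x p := by
  have hc : Continuous γ := (Isometry.of_dist_eq fun s t => by rw [hγ s t, Real.dist_eq]).continuous
  refine (continuous_const.dist hc).exists_forall_le ?_
  refine Filter.tendsto_atTop_mono' _ (f₁ := fun s : ℝ => |s| - dist x (γ 0)) ?_ ?_
  · refine Filter.Eventually.of_forall fun s => ?_
    have h1 := dist_triangle_left (γ s) (γ 0) x
    rw [hγ, sub_zero] at h1
    linarith
  · exact Filter.tendsto_atTop_add_const_right _ _
      (tendsto_norm_cocompact_atTop (E := ℝ))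

theorem FourPoint.nearest_add_le {X : Type*} [MetricSpace X] {K : ℝ} (hK : 0 < K)
    (hX : FourPoint X K) {γ : ℝ → X} (hγ : IsGeodesicLine γ) {x : X} {p : ℝ}
    (hp : IsNearestParam γ x p) (s : ℝ) :
    dist x (γ p) + |s - p| - 3 * K ≤ dist x (γ s) := by
  by_cases h : |s - p| < 2 * K
  · linarith [hp s]
  push Not at h
  obtain ⟨m, h1, h2⟩ : ∃ m, |p - m| = 2 * K ∧ |m - s| = |s - p| - 2 * K := by
    rcases le_total p s with hs | hs
    · rw [abs_of_nonneg (sub_nonneg.2 hs)] at h ⊢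
      refine ⟨p + 2 * K, ?_, ?_⟩
      · rw [abs_of_nonpos] <;> linarith
      · rw [abs_of_nonpos] <;> linarith
    · rw [abs_of_nonpos (sub_nonpos.2 hs)] at h ⊢
      refine ⟨p - 2 * K, ?_, ?_⟩
      · rw [abs_of_nonneg] <;> linarith
      · rw [abs_of_nonneg] <;> linarith
  have hm := hp m
  have c := abs_sub_comm s p
  rcases hX x (γ p) (γ m) (γ s) with h' | h' <;> rw [hγ, hγ] at h' <;> linarith

theorem FourPoint.nearest_nearest {X : Type*} [MetricSpace X] {K : ℝ} (hK : 0 < K)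
    (hX : FourPoint X K) {γ : ℝ → X} (hγ : IsGeodesicLine γ) {x y : X} {p q : ℝ}
    (hp : IsNearestParam γ x p) (hq : IsNearestParam γ y q) :
    |p - q| ≤ 4 * K ∨ dist x (γ p) + dist y (γ q) + |p - q| - 7 * K ≤ dist x y := by
  have h1 := hX.nearest_add_le hK hγ hp q
  have h2 := hX.nearest_add_le hK hγ hq p
  have c1 := abs_sub_comm p q
  have c2 := dist_comm y (γ p)
  have c3 := dist_comm y (γ q)
  have c4 := hγ q p
  rcases hX x y (γ q) (γ p) with h' | h'
  · right
    linarith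
  · left
    linarith

/-- Two lines fellow travel along any stretch on which one has large projection to the other. -/
theorem FourPoint.fellow_travel {X : Type*} [MetricSpace X] {K : ℝ} (hK : 0 < K)
    (hX : FourPoint X K) {γ η : ℝ → X} (hγ : IsGeodesicLine γ) (hη : IsGeodesicLine η)
    {a b p q N : ℝ} (hp : IsNearestParam γ (η a) p) (hq : IsNearestParam γ (η b) q)
    (hN : 0 ≤ N) (hpq : N + 7 * K < |p - q|) :
    ∃ (s p' : ℝ) (σ : ℤ), |(σ : ℝ)| = 1 ∧ ∀ t ∈ Icc 0 N,
      dist (η (s + t)) (γ (p' + σ * t)) ≤ 11 * K := by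
  wlog hab : a ≤ b generalizing a b p q
  · exact this hq hp (by rwa [abs_sub_comm]) (le_of_not_ge hab)
  have h := hX.nearest_nearest hK hγ hp hq
  replace h := h.resolve_left (by linarith)
  have hba : dist (η a) (η b) = b - a := by
    rw [hη, abs_sub_comm, abs_of_nonneg (by linarith)]
  obtain ⟨σ, hσ₁, hσ⟩ : ∃ σ : ℤ, |(σ : ℝ)| = 1 ∧ ∀ t, 0 ≤ t → t ≤ |p - q| →
      |p + σ * t - p| = t ∧ |p + σ * t - q| = |p - q| - t := by
    rcases le_total p q with hs | hs
    · refine ⟨1, by simp, fun t h0 ht => ?_⟩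
      rw [abs_of_nonpos (sub_nonpos.2 hs)] at ht ⊢
      push_cast
      rw [abs_of_nonneg (by linarith), abs_of_nonpos (by linarith)]
      constructor <;> ring
    · refine ⟨-1, by simp, fun t h0 ht => ?_⟩
      rw [abs_of_nonneg (sub_nonneg.2 hs)] at ht ⊢
      push_cast
      rw [abs_of_nonpos (by linarith), abs_of_nonneg (by linarith)]
      constructor <;> ring
  refine ⟨a + dist (η a) (γ p), p, σ, hσ₁, fun t ht => ?_⟩
  set e := dist (η a) (γ p) with he
  have he0 : 0 ≤ e := dist_nonneg
  have he1 : 0 ≤ dist (η b) (γ q) := dist_nonneg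
  obtain ⟨g1, g2⟩ := hσ t ht.1 (by linarith [ht.2])
  have k1 := hX.nearest_add_le hK hγ hp (p + σ * t)
  have k2 := dist_triangle (η a) (γ p) (γ (p + σ * t))
  have k3 := dist_triangle (η b) (γ q) (γ (p + σ * t))
  rw [hγ, abs_sub_comm] at k2 k3
  have k4 : dist (η a) (η (a + e + t)) = e + t := by
    rw [hη, abs_of_nonpos] <;> linarith [ht.1]
  have k5 : dist (η b) (η (a + e + t)) = b - a - e - t := by
    rw [hη, abs_of_nonneg] <;> linarith [ht.2]
  rw [g1] at k1 k2
  rw [g2] at k3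
  have c1 := dist_comm (η b) (η (a + e + t))
  have c2 := dist_comm (η b) (γ (p + σ * t))
  rcases hX (η a) (η (a + e + t)) (η b) (γ (p + σ * t)) with h' | h' <;> linarith

theorem FourPoint.nearest_parallel {X : Type*} [MetricSpace X] {K : ℝ} (hK : 0 < K)
    (hX : FourPoint X K) {γ η : ℝ → X} (hγ : IsGeodesicLine γ) {R s p' σ : ℝ} (hσ : |σ| = 1)
    (h : ∀ t, dist (η (s + t)) (γ (p' + σ * t)) ≤ R) {x : X} {a b : ℝ}
    (ha : IsNearestParam γ x a) (hb : IsNearestParam η x b) :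
    |p' + σ * (b - s) - a| ≤ 2 * R + 3 * K := by
  have hσ2 : σ * σ = 1 := by rw [← abs_mul_abs_self, hσ, one_mul]
  have h1 := h (b - s)
  have h2 := h (σ * (a - p'))
  rw [add_sub_cancel] at h1
  rw [← mul_assoc, hσ2, one_mul, add_sub_cancel] at h2
  have h3 := hX.nearest_add_le hK hγ ha (p' + σ * (b - s))
  have h4 := hb (s + σ * (a - p'))
  have t1 := dist_triangle x (η b) (γ (p' + σ * (b - s)))
  have t2 := dist_triangle_right x (η (s + σ * (a - p'))) (γ a)
  linarith

theorem FourPoint.abs_sub_abs_le_of_parallel {X : Type*} [MetricSpace X] {K : ℝ} (hK : 0 < K)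
    (hX : FourPoint X K) {γ η : ℝ → X} (hγ : IsGeodesicLine γ) {R s p' σ : ℝ} (hσ : |σ| = 1)
    (h : ∀ t, dist (η (s + t)) (γ (p' + σ * t)) ≤ R) {x y : X} {a b a' b' : ℝ}
    (ha : IsNearestParam γ x a) (hb : IsNearestParam η x b)
    (ha' : IsNearestParam γ y a') (hb' : IsNearestParam η y b') :
    |(|a - a'| - |b - b'|)| ≤ 4 * R + 6 * K := by
  have h1 := hX.nearest_parallel hK hγ hσ h ha hb
  have h2 := hX.nearest_parallel hK hγ hσ h ha' hb'
  have e : |b - b'| = |σ * (b - b')| := by rw [abs_mul, hσ, one_mul]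
  rw [e, abs_sub_comm]
  refine (abs_abs_sub_abs_le _ _).trans ?_
  have e2 : σ * (b - b') - (a - a') =
      (p' + σ * (b - s) - a) - (p' + σ * (b' - s) - a') := by ring
  rw [e2]
  refine (abs_sub _ _).trans ?_
  linarith

/-- Behrstock's inequality for two lines. -/
theorem FourPoint.behrstock {X : Type*} [MetricSpace X] {K : ℝ} (hK : 0 < K)
    (hX : FourPoint X K) {γ η : ℝ → X} (hγ : IsGeodesicLine γ) (hη : IsGeodesicLine η)
    {x : X} {p a b c : ℝ} (hp : IsNearestParam γ x p) (ha : IsNearestParam η x a)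
    (hb : IsNearestParam γ (η a) b) (hc : IsNearestParam η (γ b) c) :
    |p - b| ≤ 4 * K ∨ |a - c| ≤ 10 * K := by
  refine (hX.nearest_nearest hK hγ hp hb).imp_right fun h => ?_
  have h1 := hX.nearest_add_le hK hη hc a
  have h2 := ha c
  have t1 := dist_triangle x (γ p) (γ b)
  have t2 := dist_triangle x (γ b) (η c)
  have c1 := dist_comm (γ b) (η a)
  rw [hγ] at t1
  linarith

theorem projDist_range_bounds {X : Type*} [MetricSpace X] {K : ℝ} (hK : 0 < K)
    (hX : FourPoint X K) {γ : ℝ → X} (hγ : IsGeodesicLine γ) {x y : X} {p q : ℝ}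
    (hp : IsNearestParam γ x p) (hq : IsNearestParam γ y q) :
    |p - q| ≤ projDist (range γ) {x} {y} ∧
      projDist (range γ) {x} {y} ≤ |p - q| + 6 * K := by
  have hmem : ∀ {z : X} {a : ℝ}, IsNearestParam γ z a → γ a ∈ nearestPts (range γ) z := by
    intro z a ha
    refine ⟨mem_range_self a, le_antisymm ?_ (infDist_le_dist_of_mem (mem_range_self a))⟩
    refine (le_infDist (range_nonempty γ)).2 ?_
    rintro _ ⟨s, rfl⟩
    exact ha s
  have hclose : ∀ {z : X} {a : ℝ}, IsNearestParam γ z a → ∀ u ∈ nearestPts (range γ) z,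
      dist u (γ a) ≤ 3 * K := by
    rintro z a ha _ ⟨⟨s, rfl⟩, hs⟩
    have h1 := hX.nearest_add_le hK hγ ha s
    have h2 := infDist_le_dist_of_mem (x := z) (mem_range_self (f := γ) a)
    rw [hγ]
    linarith
  have hset : projSet (range γ) ({x} ∪ {y}) =
      nearestPts (range γ) x ∪ nearestPts (range γ) y := by
    simp [projSet, union_comm]
  have hle : ∀ u ∈ projSet (range γ) ({x} ∪ {y}), ∀ v ∈ projSet (range γ) ({x} ∪ {y}),
      dist u v ≤ |p - q| + 6 * K := by
    rw [hset]
    have hpq := hγ p q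
    have h0 := abs_nonneg (p - q)
    rintro u (hu | hu) v (hv | hv)
    · have := dist_triangle_right u v (γ p)
      linarith [hclose hp u hu, hclose hp v hv]
    · have := dist_triangle4 u (γ p) (γ q) v
      rw [dist_comm (γ q) v] at this
      linarith [hclose hp u hu, hclose hq v hv]
    · have := dist_triangle4 u (γ q) (γ p) v
      rw [dist_comm (γ p) v, dist_comm (γ q) (γ p)] at this
      linarith [hclose hq u hu, hclose hp v hv]
    · have := dist_triangle_right u v (γ q)
      linarith [hclose hq u hu, hclose hq v hv]
  refine ⟨?_, diam_le_of_forall_dist_le (by positivity) hle⟩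
  rw [← hγ]
  refine dist_le_diam_of_mem (isBounded_iff.2 ⟨_, fun u hu v hv => hle u hu v hv⟩) ?_ ?_ <;>
    rw [hset]
  · exact Or.inl (hmem hp)
  · exact Or.inr (hmem hq)

theorem zpow_smul_axis {X G : Type*} [Group G] [MulAction G X] {f : G} {ℓ : ℝ → X}
    (haxis : ∀ t : ℝ, f • ℓ t = ℓ (t + 1)) (k : ℤ) (t : ℝ) : f ^ k • ℓ t = ℓ (t + k) := by
  induction k with
  | zero => simp
  | succ n ih =>
    rw [zpow_add, zpow_one, (Commute.refl f).zpow_left n |>.eq, mul_smul, ih, haxis]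
    push_cast
    rw [add_assoc]
  | pred n ih =>
    rw [sub_eq_add_neg, zpow_add, (Commute.refl f).zpow_zpow _ _ |>.eq, mul_smul, ih,
      zpow_neg_one, inv_smul_eq_iff, haxis]
    congr 1
    push_cast
    ring

/-- A family of coarse projections to lines, as in the projection complex axioms: `P i` is the
projection to the `i`-th line, `q i j` is the projection of the `j`-th line to the `i`-th one,
`sim` is the relation of being parallel and `r i` is the distance from `x₀` to the `i`-th line. -/
structure ProjectionSystem (I X : Type*) (x₀ : X) (C : ℝ) where
  P : I → X → ℝ
  q : I → I → ℝ
  sim : I → I → Prop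
  r : I → ℝ
  sim_symm : ∀ v w, sim v w → sim w v
  sim_le : ∀ v w, sim v w → ∀ x y, |P w x - P w y| ≤ |P v x - P v y| + C
  behrstock : ∀ v w, ¬ sim v w → ∀ x, |P v x - q v w| ≤ C ∨ |P w x - q w v| ≤ C
  r_nonneg : ∀ v, 0 ≤ r v
  r_lt : ∀ v w, ¬ sim v w → 10 * C < |P v x₀ - q v w| → r v + C < r w

theorem exists_almost_min {I : Type*} {r : I → ℝ} (hr : ∀ i, 0 ≤ r i) {C : ℝ} (hC : 0 < C)
    {W : Set I} (hW : W.Nonempty) : ∃ w ∈ W, ∀ z ∈ W, r w ≤ r z + C := by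
  obtain ⟨_, ⟨w, hw, rfl⟩, hlt⟩ := exists_lt_of_csInf_lt (hW.image r)
    (lt_add_of_pos_right (sInf (r '' W)) hC)
  refine ⟨w, hw, fun z hz => ?_⟩
  have : sInf (r '' W) ≤ r z := csInf_le ⟨0, by rintro _ ⟨i, _, rfl⟩; exact hr i⟩ ⟨z, hz, rfl⟩
  linarith

theorem exists_first {p : ℕ → Prop} {a b : ℕ} (hab : a ≤ b) (hb : p b) :
    ∃ c, a ≤ c ∧ c ≤ b ∧ p c ∧ ∀ t, a ≤ t → t < c → ¬ p t := by
  classical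
  have hex : ∃ c, a ≤ c ∧ p c := ⟨b, hab, hb⟩
  refine ⟨Nat.find hex, (Nat.find_spec hex).1, Nat.find_min' hex ⟨hab, hb⟩,
    (Nat.find_spec hex).2, fun t hat ht hpt => Nat.find_min hex ht ⟨hat, hpt⟩⟩

theorem exists_last {p : ℕ → Prop} {a b : ℕ} (hab : a ≤ b) (ha : p a) :
    ∃ c, a ≤ c ∧ c ≤ b ∧ p c ∧ ∀ t, c < t → t ≤ b → ¬ p t := by
  classical
  refine ⟨Nat.findGreatest p b, Nat.le_findGreatest hab ha, Nat.findGreatest_le b,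
    Nat.findGreatest_spec hab ha, fun t ht htb => Nat.findGreatest_is_greatest ht htb⟩

namespace ProjectionSystem

variable {I X : Type*} {x₀ : X} {C : ℝ}

theorem not_sim (σ : ProjectionSystem I X x₀ C) {v w : I} {x y : X}
    (h : |σ.P v x - σ.P v y| + C < |σ.P w x - σ.P w y|) : ¬ σ.sim v w := fun hs =>
  absurd (σ.sim_le v w hs x y) (not_le.2 h)

/-- If `z` precedes `w`, then the projection to `z` is almost constant on the points whose
projection to `w` is far from that of `x₀`. -/
theorem near_of_precedes (σ : ProjectionSystem I X x₀ C) {z w : I} (hzw : ¬ σ.sim z w)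
    (hlt : C < |σ.P z x₀ - σ.q z w|) {x : X} (hx : 2 * C < |σ.P w x₀ - σ.P w x|) :
    |σ.P z x - σ.q z w| ≤ C := by
  have h0 := (σ.behrstock z w hzw x₀).resolve_left (not_le.2 hlt)
  refine (σ.behrstock z w hzw x).resolve_right fun h1 => ?_
  have := abs_sub_le (σ.P w x₀) (σ.q w z) (σ.P w x)
  rw [abs_sub_comm (σ.q w z)] at this
  linarith

/-- If `w` does not precede `v`, then the projection to `v` is almost constant on the points whose
projection to `w` is far from that of `x₀`. -/
theorem near_of_not_precedes (σ : ProjectionSystem I X x₀ C) {v w : I} (hvw : ¬ σ.sim v w)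
    (hle : |σ.P w x₀ - σ.q w v| ≤ C) {x : X} (hx : 2 * C < |σ.P w x₀ - σ.P w x|) :
    |σ.P v x - σ.q v w| ≤ C := by
  refine (σ.behrstock v w hvw x).resolve_right fun h1 => ?_
  have := abs_sub_le (σ.P w x₀) (σ.q w v) (σ.P w x)
  rw [abs_sub_comm (σ.q w v)] at this
  linarith

/-- A line preceding the almost closest line `w` cannot be seen from a later point. -/
theorem lt_of_almost_min (σ : ProjectionSystem I X x₀ C) (hC : 0 < C) {D : ℝ} (hD : 100 * C ≤ D)
    {W : Set I} {w z : I} (hmin : ∀ z ∈ W, σ.r w ≤ σ.r z + C) (hzw : ¬ σ.sim z w)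
    (hlt : C < |σ.P z x₀ - σ.q z w|) {x y : X} (hx : 290 * D ≤ |σ.P w x₀ - σ.P w x|)
    (hy : 260 * D < |σ.P w x₀ - σ.P w y|)
    (hW : 290 * D ≤ |σ.P z x₀ - σ.P z x| → z ∈ W) :
    |σ.P z x₀ - σ.P z y| < 299 * D := by
  by_contra! hz
  have h1 := σ.near_of_precedes hzw hlt (x := x) (by linarith)
  have h2 := σ.near_of_precedes hzw hlt (x := y) (by linarith)
  have t1 := abs_sub_le (σ.P z x₀) (σ.q z w) (σ.P z y)
  have t2 := abs_sub_le (σ.P z x₀) (σ.P z x) (σ.q z w)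
  rw [abs_sub_comm (σ.q z w)] at t1
  have h3 := hmin z (hW (by linarith))
  have h4 := σ.r_lt z w hzw (by linarith)
  linarith

/-- Along a coarsely Lipschitz path, all of whose points have a large projection to some line,
the projection to a line that is not preceded by others cannot decrease. -/
theorem no_descent (σ : ProjectionSystem I X x₀ C) (hC : 0 < C) {D : ℝ} (hD : 100 * C ≤ D)
    {n t₁ : ℕ} {y : ℕ → X} (hL : ∀ v, ∀ t < n, |σ.P v (y t) - σ.P v (y (t + 1))| ≤ C)
    (hbad : ∀ t, t₁ ≤ t → t ≤ n → ∃ u, 299 * D ≤ |σ.P u x₀ - σ.P u (y t)|)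
    (v : I) (a b : ℕ) (ha₁ : t₁ ≤ a) (hab : a ≤ b) (hbn : b ≤ n)
    (ha : 290 * D ≤ |σ.P v x₀ - σ.P v (y a)|)
    (hb : |σ.P v x₀ - σ.P v (y b)| ≤ 260 * D)
    (hmid : ∀ t, a ≤ t → t < b → 260 * D < |σ.P v x₀ - σ.P v (y t)|)
    (hH : ∀ t, a ≤ t → t < b → ∀ z, ¬ σ.sim z v → C < |σ.P z x₀ - σ.q z v| →
      |σ.P z x₀ - σ.P z (y t)| < 299 * D) : False := by
  induction hm : b - a using Nat.strong_induction_on generalizing v a b with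
  | _ m ih =>
  obtain ⟨c, hac, hcb, hc, hlast⟩ :=
    exists_last (p := fun t => 290 * D ≤ |σ.P v x₀ - σ.P v (y t)|) hab ha
  have hcb' : c < b := by
    refine lt_of_le_of_ne hcb ?_
    rintro rfl
    linarith
  have hstep := hL v c (by omega)
  have htri := abs_sub_le (σ.P v x₀) (σ.P v (y (c + 1))) (σ.P v (y c))
  rw [abs_sub_comm (σ.P v (y (c + 1)))] at htri
  have hcb'' : c + 1 < b := by
    refine lt_of_le_of_ne hcb' ?_
    rintro rfl
    linarith
  have hle : ∀ t, c < t → t ≤ b → |σ.P v x₀ - σ.P v (y t)| < 290 * D :=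
    fun t h1 h2 => not_le.1 (hlast t h1 h2)
  set W : Set I := {w | ¬ σ.sim v w ∧ |σ.P w x₀ - σ.q w v| ≤ C ∧
    290 * D ≤ |σ.P w x₀ - σ.P w (y (c + 1))|}
  have hcand : ∀ t, c < t → t < b → ∀ z, 299 * D ≤ |σ.P z x₀ - σ.P z (y t)| →
      ¬ σ.sim v z ∧ |σ.P z x₀ - σ.q z v| ≤ C := by
    intro t h1 h2 z hz
    have hvz : ¬ σ.sim v z := σ.not_sim (x := x₀) (y := y t) (by linarith [hle t h1 h2.le])
    refine ⟨hvz, not_lt.1 fun h => ?_⟩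
    linarith [hH t (by omega) h2 z (fun h' => hvz (σ.sim_symm _ _ h')) h]
  have hW : W.Nonempty := by
    obtain ⟨u, hu⟩ := hbad (c + 1) (by omega) (by omega)
    obtain ⟨h1, h2⟩ := hcand (c + 1) (by omega) hcb'' u hu
    exact ⟨u, h1, h2, by linarith⟩
  obtain ⟨w, ⟨hvw, hwv, hw⟩, hmin⟩ := exists_almost_min σ.r_nonneg hC hW
  have hwb : |σ.P w x₀ - σ.P w (y b)| ≤ 260 * D := by
    by_contra! h
    have h1 := σ.near_of_not_precedes hvw hwv (x := y (c + 1)) (by linarith)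
    have h2 := σ.near_of_not_precedes hvw hwv (x := y b) (by linarith)
    have t1 := abs_sub_le (σ.P v x₀) (σ.P v (y b)) (σ.P v (y (c + 1)))
    have t2 := abs_sub_le (σ.P v (y b)) (σ.q v w) (σ.P v (y (c + 1)))
    rw [abs_sub_comm (σ.q v w)] at t2
    linarith
  obtain ⟨b', hb1, hb2, hb3, hb4⟩ :=
    exists_first (p := fun t => |σ.P w x₀ - σ.P w (y t)| ≤ 260 * D) hcb''.le hwb
  refine ih (b' - (c + 1)) (by omega) w (c + 1) b' (by omega) hb1 (by omega) hw hb3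
    (fun t h1 h2 => not_le.1 (hb4 t h1 h2)) (fun t h1 h2 z hzw hz => ?_) rfl
  by_contra! hzt
  obtain ⟨k1, k2⟩ := hcand t (by omega) (by omega) z hzt
  exact absurd hzt (not_le.2 (σ.lt_of_almost_min hC hD hmin hzw hz hw
    (not_le.1 (hb4 t h1 h2)) fun h => ⟨k1, k2, h⟩))

/-- An almost closest line among those seen from the start of the path is seen from its end. -/
theorem persists (σ : ProjectionSystem I X x₀ C) (hC : 0 < C) {D : ℝ} (hD : 100 * C ≤ D)
    {n t₁ : ℕ} (ht₁ : t₁ ≤ n) {y : ℕ → X}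
    (hL : ∀ v, ∀ t < n, |σ.P v (y t) - σ.P v (y (t + 1))| ≤ C)
    (hbad : ∀ t, t₁ ≤ t → t ≤ n → ∃ u, 299 * D ≤ |σ.P u x₀ - σ.P u (y t)|)
    {u : I} (hu : 290 * D ≤ |σ.P u x₀ - σ.P u (y t₁)|)
    (hmin : ∀ z ∈ {z | 290 * D ≤ |σ.P z x₀ - σ.P z (y t₁)|}, σ.r u ≤ σ.r z + C) :
    260 * D < |σ.P u x₀ - σ.P u (y n)| := by
  by_contra! h
  obtain ⟨b, hb1, hb2, hb3, hb4⟩ :=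
    exists_first (p := fun t => |σ.P u x₀ - σ.P u (y t)| ≤ 260 * D) ht₁ h
  exact σ.no_descent hC hD hL hbad u t₁ b le_rfl hb1 hb2 hu hb3
    (fun t h1 h2 => not_le.1 (hb4 t h1 h2)) fun t h1 h2 z hzu hz =>
      σ.lt_of_almost_min hC hD hmin hzu hz hu (not_le.1 (hb4 t h1 h2)) fun h => h

end ProjectionSystem

section Action

variable {X : Type*} [MetricSpace X] {G : Type*} [Group G] [MulAction G X]

/-- The WPD property makes a translate of the axis parallel to the axis as soon as the two fellow
travel for a sufficiently long time. -/
theorem WPD.exists_parallel {f : G} {ℓ : ℝ → X}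
    (hiso : ∀ (g : G) (x y : X), dist (g • x) (g • y) = dist x y)
    (hℓ : IsGeodesicLine ℓ) (haxis : ∀ t : ℝ, f • ℓ t = ℓ (t + 1)) (hwpd : WPD f (ℓ 0))
    {R : ℝ} (hR : 0 ≤ R) :
    ∃ N : ℝ, 0 ≤ N ∧ ∀ (u : G) (s p : ℝ) (σ : ℤ),
      (∀ t ∈ Icc 0 N, dist (u • ℓ (s + t)) (ℓ (p + σ * t)) ≤ R) →
      ∀ t, dist (u • ℓ (s + t)) (ℓ (p + σ * t)) ≤ R := by
  obtain ⟨L, -, hfin⟩ := hwpd (2 * R + 3) (by linarith)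
  set F := hfin.toFinset with hF
  refine ⟨L + F.card, by positivity, fun u s p σ hN => ?_⟩
  have hf := zpow_smul_axis haxis
  set k : ℤ := ⌊s⌋ with hk
  have hks : |(k : ℝ) - s| ≤ 1 := by
    rw [abs_sub_comm, abs_of_nonneg (sub_nonneg.2 (Int.floor_le s))]
    linarith [Int.lt_floor_add_one s]
  have hmove : ∀ j : ℕ, j ≤ F.card → ∀ t ∈ Icc (0 : ℝ) L,
      dist (ℓ (k + t)) ((u⁻¹ * f ^ (-(σ * j)) * u * f ^ (j : ℤ)) • ℓ (k + t)) < 2 * R + 3 := by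
    intro j hj t ht
    have hj' : (j : ℝ) ≤ F.card := by exact_mod_cast hj
    have hj0 : (0 : ℝ) ≤ j := by positivity
    set h := u⁻¹ * f ^ (-(σ * j)) * u * f ^ (j : ℤ) with hh
    have e1 : dist (ℓ (k + t)) (ℓ (s + t)) ≤ 1 := by rwa [hℓ, add_sub_add_right_eq_sub]
    have e2 : dist (ℓ (s + t)) (h • ℓ (s + t)) ≤ 2 * R := by
      have a1 := hN t ⟨ht.1, by linarith [ht.2]⟩
      have a2 := hN (t + j) ⟨by linarith [ht.1], by linarith [ht.2]⟩
      rw [← hiso (f ^ (-(σ * j))), hf] at a2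
      have e3 : p + σ * (t + j) + ((-(σ * j) : ℤ) : ℝ) = p + σ * t := by push_cast; ring
      rw [e3] at a2
      rw [← hiso u, hh, mul_smul, mul_smul, mul_smul, smul_inv_smul, hf]
      push_cast
      rw [add_assoc s]
      refine (dist_triangle_right _ _ (ℓ (p + σ * t))).trans ?_
      linarith
    have e4 := dist_triangle4 (ℓ (k + t)) (ℓ (s + t)) (h • ℓ (s + t)) (h • ℓ (k + t))
    rw [hiso, dist_comm (ℓ (s + t)) (ℓ (k + t))] at e4
    linarith
  have hmaps : ∀ j ∈ Finset.range (F.card + 1),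
      f ^ (-k) * (u⁻¹ * f ^ (-(σ * j)) * u * f ^ (j : ℤ)) * f ^ k ∈ F := by
    intro j hj
    replace hj : j ≤ F.card := Nat.lt_succ_iff.1 (Finset.mem_range.1 hj)
    rw [hF, Set.Finite.mem_toFinset]
    have hL : (f ^ L) • ℓ 0 = ℓ L := by simpa using hf L 0
    refine ⟨?_, ?_⟩
    · have h1 := hmove j hj 0 ⟨le_rfl, by positivity⟩
      rw [← hiso (f ^ (-k)), hf] at h1
      rw [mul_smul, mul_smul, hf]
      rw [add_zero] at h1
      rw [zero_add]
      simpa using h1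
    · have h1 := hmove j hj L ⟨by positivity, le_rfl⟩
      rw [← hiso (f ^ (-k)), hf] at h1
      rw [mul_smul, hL, mul_smul, mul_smul, hf, add_comm (L : ℝ)]
      have e5 : (k : ℝ) + L + ((-k : ℤ) : ℝ) = L := by push_cast; ring
      rwa [e5] at h1
  obtain ⟨m, hm, hmF, hsemi⟩ : ∃ m : ℕ, 0 < m ∧ m ≤ F.card ∧
      SemiconjBy u (f ^ (m : ℤ)) (f ^ (σ * m)) := by
    obtain ⟨i, hi, j, hj, hne, heq⟩ := Finset.exists_ne_map_eq_of_card_lt_of_maps_to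
      (by simp) hmaps
    wlog hij : i < j generalizing i j
    · exact this j hj i hi hne.symm heq.symm (by omega)
    have hj' := Finset.mem_range.1 hj
    refine ⟨j - i, by omega, by omega, ?_⟩
    have h1 := mul_left_cancel (mul_right_cancel heq)
    rw [mul_assoc, mul_assoc, mul_assoc u⁻¹, mul_assoc u⁻¹] at h1
    replace h1 := mul_left_cancel h1
    rw [Nat.cast_sub hij.le]
    have h2 : u * f ^ (j : ℤ) = f ^ (σ * j) * (f ^ (-(σ * i)) * (u * f ^ (i : ℤ))) := by
      rw [← mul_assoc] at h1 ⊢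
      rw [mul_assoc, ← mul_assoc _ u, h1, ← mul_assoc, ← mul_assoc, ← zpow_add]
      simp
    change u * f ^ ((j : ℤ) - i) = f ^ (σ * ((j : ℤ) - i)) * u
    rw [zpow_sub, ← mul_assoc, h2, mul_sub, zpow_sub, zpow_neg]
    group
  intro t
  have hm' : (0 : ℝ) < m := by exact_mod_cast hm
  have hmF' : (m : ℝ) ≤ F.card := by exact_mod_cast hmF
  set z : ℤ := ⌊t / m⌋ with hz
  have hz1 : z * m ≤ t := (le_div_iff₀ hm').1 (Int.floor_le _)
  have hz2 : t < (z + 1) * m := (div_lt_iff₀ hm').1 (Int.lt_floor_add_one _)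
  have hL0 : (0 : ℝ) ≤ L := by positivity
  have h1 := hN (t - z * m) ⟨by linarith, by linarith⟩
  have h2 := (hsemi.zpow_right z).eq
  rw [← zpow_mul, ← zpow_mul] at h2
  rw [← hiso (f ^ (σ * m * z)), ← mul_smul, ← h2, mul_smul, hf, hf] at h1
  push_cast at h1
  have e1 : s + (t - z * m) + m * z = s + t := by ring
  have e2 : p + σ * (t - z * m) + σ * m * z = p + σ * t := by ring
  rwa [e1, e2] at h1

/-- The translates of the axis of a WPD loxodromic form a projection system. -/
theorem WPD.exists_projectionSystem {K : ℝ} (hK : 0 < K) (hX : FourPoint X K) {f : G} {ℓ : ℝ → X}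
    (hiso : ∀ (g : G) (x y : X), dist (g • x) (g • y) = dist x y)
    (hℓ : IsGeodesicLine ℓ) (haxis : ∀ t : ℝ, f • ℓ t = ℓ (t + 1)) (hwpd : WPD f (ℓ 0)) (x₀ : X) :
    ∃ C₀ : ℝ, 0 < C₀ ∧ ∀ C, C₀ ≤ C → ∃ σ : ProjectionSystem G X x₀ C,
      ∀ v x, IsNearestParam (fun t => v • ℓ t) x (σ.P v x) := by
  obtain ⟨N, hN, hpar⟩ := hwpd.exists_parallel hiso hℓ haxis (R := 11 * K) (by positivity)
  have hline : ∀ v : G, IsGeodesicLine fun t => v • ℓ t := fun v s t => by rw [hiso, hℓ]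
  choose P hP using fun v : G => (hline v).exists_isNearestParam
  set par : G → G → Prop := fun v w => ∃ (s p : ℝ) (σ : ℤ), |(σ : ℝ)| = 1 ∧
    ∀ t, dist (w • ℓ (s + t)) (v • ℓ (p + σ * t)) ≤ 11 * K
  have hbdd : ∀ v w, ¬ par v w → ∀ a b, |P v (w • ℓ a) - P v (w • ℓ b)| ≤ N + 7 * K := by
    intro v w hvw a b
    by_contra! hlt
    obtain ⟨s, p, σ, hσ, h⟩ := hX.fellow_travel hK (hline v) (hline w) (hP v (w • ℓ a))
      (hP v (w • ℓ b)) hN hlt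
    have key : ∀ t : ℝ, dist (w • ℓ (s + t)) (v • ℓ (p + σ * t)) =
        dist ((v⁻¹ * w) • ℓ (s + t)) (ℓ (p + σ * t)) := fun t => by
      rw [← hiso v⁻¹, inv_smul_smul, mul_smul]
    refine hvw ⟨s, p, σ, hσ, fun t => ?_⟩
    rw [key]
    exact hpar _ s p σ (fun t ht => by rw [← key]; exact h t ht) t
  have hcomp : ∀ v w, par v w → ∀ x y,
      |(|P v x - P v y| - |P w x - P w y|)| ≤ 50 * K := by
    rintro v w ⟨s, p, σ, hσ, h⟩ x y
    have := hX.abs_sub_abs_le_of_parallel (γ := fun t => v • ℓ t) (η := fun t => w • ℓ t) hK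
      (hline v) hσ h (hP v x) (hP w x) (hP v y) (hP w y)
    linarith
  refine ⟨N + 50 * K, by positivity, fun C hC => ⟨
    { P := P
      q := fun v w => P v (w • ℓ 0)
      sim := fun v w => par v w ∨ par w v
      r := fun v => dist x₀ (v • ℓ (P v x₀))
      sim_symm := fun v w h => h.symm
      sim_le := ?_
      behrstock := ?_
      r_nonneg := fun v => dist_nonneg
      r_lt := ?_ }, hP⟩⟩
  · rintro v w (h | h) x y
    · linarith [(abs_le.1 (hcomp v w h x y)).1]
    · linarith [(abs_le.1 (hcomp w v h x y)).2]
  · intro v w h x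
    have h1 : ¬ par v w := fun h' => h (Or.inl h')
    have h2 : ¬ par w v := fun h' => h (Or.inr h')
    refine (hX.behrstock hK (hline v) (hline w) (hP v x) (hP w x) (hP v _) (hP w _)).imp
      (fun h3 => ?_) fun h3 => ?_
    · refine (abs_sub_le _ _ _).trans (le_trans (add_le_add h3 (hbdd v w h1 _ _)) ?_)
      linarith
    · refine (abs_sub_le _ _ _).trans (le_trans (add_le_add h3 (hbdd w v h2 _ _)) ?_)
      linarith
  · intro v w h hlt
    have h1 := hbdd v w (fun h' => h (Or.inl h')) (P w x₀) 0
    have h2 := abs_sub_le (P v x₀) (P v (w • ℓ (P w x₀))) (P v (w • ℓ 0))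
    have h3 := (hX.nearest_nearest hK (hline v) (hP v x₀)
      (hP v (w • ℓ (P w x₀)))).resolve_left (by linarith)
    have h4 := dist_nonneg (x := w • ℓ (P w x₀)) (y := v • ℓ (P v (w • ℓ (P w x₀))))
    linarith

end Action

theorem finite_wordNorm_le {G : Type*} [Group G] (S : Finset G)
    (hgen : Subgroup.closure (S : Set G) = ⊤) (m : ℕ) : {g : G | wordNorm S g ≤ m}.Finite := by
  set T : Set G := {x | x ∈ S ∨ x⁻¹ ∈ S}
  have hTfin : T.Finite := by
    refine ((S.finite_toSet).union (S.finite_toSet.image (·⁻¹))).subset ?_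
    rintro x (hx | hx)
    · exact Or.inl hx
    · exact Or.inr ⟨x⁻¹, hx, inv_inv x⟩
  have : Finite T := hTfin
  refine ((List.finite_length_le T m).image fun l => (l.map Subtype.val).prod).subset ?_
  intro g hg
  have hne : {n : ℕ | ∃ l : List G, l.length = n ∧ (∀ x ∈ l, x ∈ S ∨ x⁻¹ ∈ S) ∧
      l.prod = g}.Nonempty := by
    have hgS : g ∈ Subgroup.closure (S : Set G) := hgen ▸ Subgroup.mem_top g
    rw [← Subgroup.mem_toSubmonoid, Subgroup.closure_toSubmonoid] at hgS
    obtain ⟨l, hl, hprod⟩ := Submonoid.exists_list_of_mem_closure hgS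
    exact ⟨_, l, rfl, hl, hprod⟩
  obtain ⟨l, hlen, hl, hprod⟩ := Nat.sInf_mem hne
  refine ⟨l.attach.map fun x => (⟨x.1, hl x.1 x.2⟩ : T), ?_, ?_⟩
  · simpa using hlen.le.trans hg
  · simpa [List.map_map, Function.comp_def] using hprod

/-- **`𝒩𝓕_{300D}^{≥E}` is a barrier towards non-fellow-traveling elements**
(Proposition 7.6 of the paper). -/
theorem NF_barrier
    {X : Type*} [MetricSpace X] {G : Type*} [Group G] [MulAction G X]
    (δ : ℝ) (hX : GromovHyperbolic X δ)
    (hiso : ∀ (g : G) (x y : X), dist (g • x) (g • y) = dist x y)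
    (hnvc : ¬ VirtuallyCyclic G)
    (f : G) (ℓ : ℝ → X) (hgeo : ∀ s t : ℝ, dist (ℓ s) (ℓ t) = |s - t|)
    (haxis : ∀ t : ℝ, f • ℓ t = ℓ (t + 1))
    (x₀ : X) (hx₀ : x₀ ∈ Set.range ℓ) (hwpd : WPD f x₀)
    (S : Finset G) (hgen : Subgroup.closure (S : Set G) = ⊤) :
    ∃ D₀ : ℝ, 0 < D₀ ∧ ∀ D : ℝ, D₀ ≤ D → ∀ E : ℝ, 0 < E → ∃ E' : ℝ, 0 < E' ∧
      ∀ g : G,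
        (¬ ∃ h : G, (wordNorm S h : ℝ) ≤ E' ∧
            250 * D ≤ projDist (h • Set.range ℓ) {x₀} {g • x₀}) →
        E ≤ (wordNorm S g : ℝ) →
        ∀ (n : ℕ) (γ : ℕ → G), γ 0 = 1 → γ n = g →
          (∀ k < n, wordDist S (γ k) (γ (k + 1)) ≤ 1) →
          ∃ t ≤ n, (∀ u : G, projDist (u • Set.range ℓ) {x₀} {γ t • x₀} < 300 * D) ∧
            E ≤ (wordNorm S (γ t) : ℝ) := by
  obtain ⟨τ, rfl⟩ := hx₀
  have hδ : 0 ≤ δ := by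
    obtain ⟨α, hα⟩ := hX.1 (ℓ τ) (ℓ τ)
    obtain ⟨u, -, hu⟩ := hX.2 _ _ _ α α α hα hα hα 0 ⟨le_rfl, dist_nonneg⟩
    exact dist_nonneg.trans hu
  have hK : 0 < 6 * δ + 4 := by linarith
  have hX4 := hX.fourPoint hδ
  set K := 6 * δ + 4
  set γ₀ : ℝ → X := fun t => ℓ (t + τ) with hγ₀
  have hline : IsGeodesicLine γ₀ := fun s t => by simp [hγ₀, hgeo]
  have hbase : ℓ τ = γ₀ 0 := by simp [hγ₀]
  have hrange : range ℓ = range γ₀ := ((Equiv.addRight τ).surjective.range_comp ℓ).symm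
  have hax : ∀ t, f • γ₀ t = γ₀ (t + 1) := fun t => by
    simp only [hγ₀, haxis]
    congr 1
    ring
  rw [hbase] at hwpd ⊢
  rw [hrange]
  obtain ⟨C₀, hC₀, hsys⟩ := hwpd.exists_projectionSystem hK hX4 hiso hline hax (γ₀ 0)
  obtain ⟨B, hB⟩ := ((finite_wordNorm_le S hgen 1).image
    fun s => dist (γ₀ 0) (s • γ₀ 0)).bddAbove
  set C := max C₀ (B + 7 * K)
  have hC : 0 < C := hC₀.trans_le (le_max_left _ _)
  obtain ⟨σ, hσ⟩ := hsys C (le_max_left _ _)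
  have hvline : ∀ v : G, IsGeodesicLine fun t => v • γ₀ t := fun v s t => by rw [hiso, hline]
  have hproj : ∀ (v g : G),
      |σ.P v (γ₀ 0) - σ.P v (g • γ₀ 0)| ≤ projDist (v • range γ₀) {γ₀ 0} {g • γ₀ 0} ∧
      projDist (v • range γ₀) {γ₀ 0} {g • γ₀ 0} ≤
        |σ.P v (γ₀ 0) - σ.P v (g • γ₀ 0)| + 6 * K := by
    intro v g
    have h : v • range γ₀ = range fun t => v • γ₀ t := (range_comp (v • ·) γ₀).symm
    rw [h]
    exact projDist_range_bounds hK hX4 (hvline v) (hσ v _) (hσ v _)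
  have hstep : ∀ (v g h : G), wordDist S g h ≤ 1 →
      |σ.P v (g • γ₀ 0) - σ.P v (h • γ₀ 0)| ≤ C := by
    intro v g h hgh
    have h1 : dist (γ₀ 0) ((g⁻¹ * h) • γ₀ 0) ≤ B := hB (mem_image_of_mem _ hgh)
    rw [← hiso g, ← mul_smul, mul_inv_cancel_left] at h1
    refine le_trans ?_ (le_max_right C₀ (B + 7 * K))
    rcases hX4.nearest_nearest hK (hvline v) (hσ v (g • γ₀ 0)) (hσ v (h • γ₀ 0)) with h2 | h2
    · linarith [h1.trans' dist_nonneg]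
    · linarith [dist_nonneg (x := g • γ₀ 0) (y := v • γ₀ (σ.P v (g • γ₀ 0))),
        dist_nonneg (x := h • γ₀ 0) (y := v • γ₀ (σ.P v (h • γ₀ 0)))]
  refine ⟨max (100 * C) (6 * K), lt_max_of_lt_left (by positivity), fun D hD E hE => ?_⟩
  have hD1 : 100 * C ≤ D := (le_max_left _ _).trans hD
  have hD2 : 6 * K ≤ D := (le_max_right _ _).trans hD
  have hex : ∀ g : G, ∃ u : G, (∃ w, 290 * D ≤ |σ.P w (γ₀ 0) - σ.P w (g • γ₀ 0)|) →
      290 * D ≤ |σ.P u (γ₀ 0) - σ.P u (g • γ₀ 0)| ∧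
      ∀ z ∈ {z | 290 * D ≤ |σ.P z (γ₀ 0) - σ.P z (g • γ₀ 0)|}, σ.r u ≤ σ.r z + C := by
    intro g
    by_cases h : ∃ w, 290 * D ≤ |σ.P w (γ₀ 0) - σ.P w (g • γ₀ 0)|
    · obtain ⟨u, hu⟩ := exists_almost_min σ.r_nonneg hC
        (W := {z | 290 * D ≤ |σ.P z (γ₀ 0) - σ.P z (g • γ₀ 0)|}) h
      exact ⟨u, fun _ => hu⟩
    · exact ⟨1, fun h' => absurd h' h⟩
  choose U hU using hex
  obtain ⟨E', hE'⟩ := ((Set.Finite.image2 (fun k s : G => (wordNorm S (U (k * s)) : ℝ))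
    (finite_wordNorm_le S hgen ⌈E⌉₊) (finite_wordNorm_le S hgen 1))).bddAbove
  refine ⟨max 1 E', by positivity, fun g hg hEg n γ hγ0 hγn hγ => ?_⟩
  by_contra! hno
  have hone : wordNorm S (1 : G) = 0 := Nat.sInf_eq_zero.2 (Or.inl ⟨[], by simp⟩)
  obtain ⟨t₀, -, ht₀n, ht₀, hlast⟩ := exists_last (p := fun t => (wordNorm S (γ t) : ℝ) < E)
    (Nat.zero_le n) (by simpa [hγ0, hone] using hE)
  have ht₀n' : t₀ < n := by
    refine lt_of_le_of_ne ht₀n ?_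
    rintro rfl
    rw [hγn] at ht₀
    linarith
  have hbad : ∀ t, t₀ + 1 ≤ t → t ≤ n →
      ∃ u, 299 * D ≤ |σ.P u (γ₀ 0) - σ.P u (γ t • γ₀ 0)| := by
    intro t h1 h2
    by_contra! h
    refine hlast t h1 h2 (hno t h2 fun u => ?_)
    linarith [(hproj u (γ t)).2, h u]
  obtain ⟨w, hw⟩ := hbad (t₀ + 1) le_rfl ht₀n'
  obtain ⟨hu1, hu2⟩ := hU (γ (t₀ + 1)) ⟨w, by linarith⟩
  have hfar := σ.persists (y := fun t => γ t • γ₀ 0) hC hD1 ht₀n'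
    (fun v t ht => hstep v _ _ (hγ t ht)) hbad hu1 hu2
  refine hg ⟨U (γ (t₀ + 1)), ?_, ?_⟩
  · refine le_max_of_le_right (hE' ⟨γ t₀, ?_, (γ t₀)⁻¹ * γ (t₀ + 1), hγ t₀ ht₀n', ?_⟩)
    · exact_mod_cast ht₀.le.trans (Nat.le_ceil E)
    · simp
  · have := (hproj (U (γ (t₀ + 1))) g).1
    rw [← hγn] at this ⊢
    linarith
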